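/- Let op_0 op_1 ... op_n be a valid sequence of order-2 stack operations and 0 ≤ j ≤ n with op_j = ↓2. Then k := Push2(j−1) ≥ 0 and the topmost order-1 stack of W_j (with its symbol annotations) equals the topmost order-1 stack of W_{k−1}. -/

import Mathlib

/-- Order-2 stack operations over stack alphabet `S`. -/
inductive Op (S : Type) : Type where
  | push1 : S → Op S
  | pop1  : Op S
  | push2 : Op S
  | pop2  : Op S
  | collapse : Op S
  deriving DecidableEq

/-- Annotated stack symbol: (symbol, collapse link, position annotation). -/
abbrev ASym (S : Type) : Type := S × ℕ × ℤ
/-- Annotated order-1 stack, topmost symbol first. -/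
abbrev Stk1 (S : Type) : Type := List (ASym S)
/-- Annotated order-2 stack: list of (position annotation, order-1 stack), topmost first.
In `[[u_1][u_2] ⋯ [u_n]]` the topmost stack `u_n` comes first in the list. -/
abbrev Stk2 (S : Type) : Type := List (ℤ × Stk1 S)

/-- The initial order-2 stack `[[]]`, its unique (empty) order-1 stack annotated `-1`. -/
def initStk (S : Type) : Stk2 S := [(-1, ([] : Stk1 S))]

/-- One step of the annotated semantics; `p` is the current position.
`push1 s` records the collapse link `n-1` (number of stacks below the top) and the
position annotation `p`; `push2` duplicates the top stack annotating the copy with `p`;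
`collapse` keeps the bottom `i` order-1 stacks, where `i` is the collapse link of the
topmost symbol.  Undefined operations yield `none`. -/
def step {S : Type} (p : ℕ) (op : Op S) (W : Stk2 S) : Option (Stk2 S) :=
  match op, W with
  | .push2, t :: rest => some (((p : ℤ), t.2) :: t :: rest)
  | .pop2, _ :: t :: rest => some (t :: rest)
  | .push1 s, (a, u) :: rest => some ((a, (s, rest.length, (p : ℤ)) :: u) :: rest)
  | .pop1, (a, _ :: u) :: rest => some ((a, u) :: rest)
  | .collapse, (_, (_, i, _) :: _) :: _ =>
      if 1 ≤ i ∧ i < W.length then some (W.drop (W.length - i)) else none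
  | _, _ => none

def runFrom {S : Type} (p : ℕ) (W : Stk2 S) : List (Op S) → Option (Stk2 S)
  | [] => some W
  | op :: rest => (step p op W).bind fun W' => runFrom (p + 1) W' rest

/-- `stkAt ops j` is the annotated order-2 stack `W_j` after executing `op_0 ⋯ op_j`
(for `j = -1` this is the initial stack `[[]]`). -/
def stkAt {S : Type} (ops : List (Op S)) (j : ℤ) : Option (Stk2 S) :=
  runFrom 0 (initStk S) (ops.take (j + 1).toNat)

/-- A nonempty sequence of operations is valid if every operation is defined,
starting from the empty order-2 stack `[[]]`. -/
def Valid {S : Type} (ops : List (Op S)) : Prop :=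
  ops ≠ [] ∧ (runFrom 0 (initStk S) ops).isSome

/-- `push1At ops j` is `push1(j)`: the position annotation of the topmost symbol of the
topmost order-1 stack of `W_j`, or `-1` if that stack is empty (also `-1` for `j = -1`). -/
def push1At {S : Type} (ops : List (Op S)) (j : ℤ) : ℤ :=
  match stkAt ops j with
  | some ((_, (_, _, p) :: _) :: _) => p
  | _ => -1

/-- `Push2At ops j` is `Push2(j)`: the position annotation of the topmost order-1 stack
of `W_j` (`-1` for `j = -1`). -/
def Push2At {S : Type} (ops : List (Op S)) (j : ℤ) : ℤ :=
  match stkAt ops j with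
  | some ((a, _) :: _) => a
  | _ => -1

/-- The topmost order-1 stack of an annotated order-2 stack (with its symbol annotations). -/
def top1 {S : Type} (W : Stk2 S) : Option (Stk1 S) := W.head?.map Prod.snd

def GoodStk {S : Type} (ops : List (Op S)) : Stk2 S → Prop
  | a :: t :: rest =>
      (0 ≤ a.1 ∧ (stkAt ops (a.1 - 1)).bind top1 = some t.2) ∧ GoodStk ops (t :: rest)
  | _ => True

theorem GoodStk.tail {S : Type} {ops : List (Op S)} {a : ℤ × Stk1 S} {W : Stk2 S}
    (h : GoodStk ops (a :: W)) : GoodStk ops W := by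
  cases W with
  | nil => simp [GoodStk]
  | cons t rest => exact h.2

theorem GoodStk.drop {S : Type} {ops : List (Op S)} (n : ℕ) :
    ∀ {W : Stk2 S}, GoodStk ops W → GoodStk ops (W.drop n) := by
  induction n with
  | zero => intro W h; simpa using h
  | succ n ih =>
    intro W h
    cases W with
    | nil => simpa using h
    | cons a W => simpa using ih h.tail

theorem GoodStk.retop {S : Type} {ops : List (Op S)} {a : ℤ} {u v : Stk1 S} {W : Stk2 S}
    (h : GoodStk ops ((a, u) :: W)) : GoodStk ops ((a, v) :: W) := by
  cases W with
  | nil => simp [GoodStk]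
  | cons t rest => exact h

theorem runFrom_append {S : Type} (l₁ l₂ : List (Op S)) : ∀ (p : ℕ) (W : Stk2 S),
    runFrom p W (l₁ ++ l₂) = (runFrom p W l₁).bind fun W' => runFrom (p + l₁.length) W' l₂ := by
  induction l₁ with
  | nil => intro p W; simp [runFrom]
  | cons o l ih =>
    intro p W
    simp only [List.cons_append, runFrom, Option.bind_assoc, ih, List.length_cons]
    congr 1; funext W'; congr 1; funext W''; congr 1; omega

theorem run_take_succ {S : Type} (ops : List (Op S)) (m : ℕ) (o : Op S)
    (h : ops[m]? = some o) :
    runFrom 0 (initStk S) (ops.take (m + 1)) =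
      (runFrom 0 (initStk S) (ops.take m)).bind (step m o) := by
  have hm : m < ops.length := (List.getElem?_eq_some_iff.1 h).1
  rw [List.take_add_one, h, runFrom_append]
  have : min m ops.length = m := by omega
  simp [runFrom, this]

theorem good_step {S : Type} {ops : List (Op S)} {m : ℕ} {o : Op S} {W W' : Stk2 S}
    (hW : runFrom 0 (initStk S) (ops.take m) = some W) (hg : GoodStk ops W)
    (hs : step m o W = some W') : GoodStk ops W' := by
  unfold step at hs
  split at hs
  · cases hs
    refine ⟨⟨by simp, ?_⟩, hg⟩
    simp [stkAt, hW, top1]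
  · cases hs; exact hg.tail
  · cases hs; exact hg.retop
  · cases hs; exact hg.retop
  · split at hs
    · cases hs; exact hg.drop _
    · cases hs
  · cases hs

theorem good_run {S : Type} (ops : List (Op S)) (m : ℕ) : m ≤ ops.length → ∀ W,
    runFrom 0 (initStk S) (ops.take m) = some W → GoodStk ops W := by
  induction m with
  | zero => intro _ W h; simp [runFrom, initStk] at h; subst h; simp [GoodStk]
  | succ m ih =>
    intro hm W h
    rw [run_take_succ ops m _ (List.getElem?_eq_getElem hm)] at h
    obtain ⟨V, hV, hs⟩ := Option.bind_eq_some_iff.1 h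
    exact good_step hV (ih (by omega) V hV) hs

/-- In a valid sequence, if `op_j = ↓2` then `k := Push2(j-1) ≥ 0` and
the topmost order-1 stack of `W_j` (with its symbol annotations) equals the topmost
order-1 stack of `W_{k-1}`. -/
theorem pop2_top_stack_eq {S : Type} (ops : List (Op S)) (hv : Valid ops)
    (j : ℕ) (hj : j < ops.length) (hop : ops[j]? = some Op.pop2) :
    0 ≤ Push2At ops ((j : ℤ) - 1) ∧
    ∃ u : Stk1 S,
      (stkAt ops (j : ℤ)).bind top1 = some u ∧
      (stkAt ops (Push2At ops ((j : ℤ) - 1) - 1)).bind top1 = some u := by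
  have hsome : (runFrom 0 (initStk S) (ops.take (j + 1))).isSome := by
    have h := hv.2
    rw [← List.take_append_drop (j + 1) ops, runFrom_append] at h
    exact Option.isSome_of_isSome_bind h
  obtain ⟨W', hW'⟩ := Option.isSome_iff_exists.1 hsome
  have h2 := hW'
  rw [run_take_succ ops j _ hop] at h2
  obtain ⟨W, hW, hs⟩ := Option.bind_eq_some_iff.1 h2
  have hg := good_run ops j hj.le W hW
  have e1 : stkAt ops ((j : ℤ) - 1) = some W := by simpa [stkAt] using hW
  have e2 : stkAt ops (j : ℤ) = some W' := hW'
  match W, hs, hg, e1 with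
  | [], hs, _, _ => simp [step] at hs
  | [_], hs, _, _ => simp [step] at hs
  | (a, u) :: t :: rest, hs, hg, e1 =>
    have hP : Push2At ops ((j : ℤ) - 1) = a := by simp [Push2At, e1]
    simp only [step, Option.some.injEq] at hs
    subst hs
    rw [hP, e2]
    exact ⟨hg.1.1, t.2, by simp [top1], hg.1.2⟩
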